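/- arXiv:2207.10294 — 2 statements merged into one kernel-verified Lean document; each statement's English description precedes it below -/
import Mathlib

section
/- Fix τ ≥ 0 and a reflexive, transitive relation reach on {1,…,N}, and let K : ℂ → ℂ^{m×m} belong to S_τ with square diagonal blocks (m_i = p_i for all i). Suppose there exist α > 0 and M ≥ 0 such that for every s with Re(s) > α the matrix K(s) is invertible and ‖K(s)⁻¹‖ ≤ M. Then there exists a function G : ℂ → ℂ^{m×m} belonging to S_τ (same partition, same relation reach, same τ) such that G(s) = K(s)⁻¹ for all s with Re(s) sufficiently large. In particular, for all such s, the block (K(s)⁻¹)_{ij} is zero whenever reach(j,i) fails, and e^{sτ}(K(s)⁻¹)_{ij} is bounded for i ≠ j with reach(j,i). -/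
open Matrix

attribute [local instance] Matrix.normedAddCommGroup

/-- The `(i,j)` block of a partitioned matrix indexed by sigma types. -/
def blockOf {N : ℕ} {m p : Fin N → ℕ} {α : Type*}
    (K : Matrix ((i : Fin N) × Fin (m i)) ((j : Fin N) × Fin (p j)) α)
    (i j : Fin N) : Matrix (Fin (m i)) (Fin (p j)) α :=
  K.submatrix (fun a : Fin (m i) => (⟨i, a⟩ : (i : Fin N) × Fin (m i)))
    (fun b : Fin (p j) => (⟨j, b⟩ : (j : Fin N) × Fin (p j)))

/-- Membership in the class `S_τ` of structured delayed transfer matrices: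
there is an `α > 0` such that for `Re s > α`, the `(i,j)` block vanishes whenever
`j` cannot reach `i`, the diagonal blocks are bounded, and the off-diagonal blocks
with `reach j i` are bounded after multiplication by `e^{sτ}`. -/
def MemS (N : ℕ) (m p : Fin N → ℕ) (reach : Fin N → Fin N → Prop) (τ : ℝ)
    (K : ℂ → Matrix ((i : Fin N) × Fin (m i)) ((j : Fin N) × Fin (p j)) ℂ) : Prop :=
  ∃ α > (0 : ℝ),
    (∀ s : ℂ, α < s.re → ∀ i j : Fin N, ¬ reach j i → blockOf (K s) i j = 0) ∧
    (∀ i : Fin N, ∃ c : ℝ, ∀ s : ℂ, α < s.re → ‖blockOf (K s) i i‖ ≤ c) ∧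
    (∀ i j : Fin N, i ≠ j → reach j i →
      ∃ c : ℝ, ∀ s : ℂ, α < s.re → ‖Complex.exp (s * τ) • blockOf (K s) i j‖ ≤ c)

/-- Matrices whose `(a, b)` entry vanishes unless `r (f b) (f a)`, for a preorder `r` on labels. -/
def preorderSubalgebra {ι κ : Type*} [Fintype ι] [DecidableEq ι] (f : ι → κ) (r : κ → κ → Prop)
    (hrefl : ∀ i, r i i) (htrans : ∀ i j k, r i j → r j k → r i k) :
    Subalgebra ℂ (Matrix ι ι ℂ) where
  carrier := {A | ∀ a b, ¬ r (f b) (f a) → A a b = 0}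
  mul_mem' := by
    intro A B hA hB a b hab
    rw [Matrix.mul_apply]
    refine Finset.sum_eq_zero fun c _ => ?_
    by_cases hc : r (f c) (f a)
    · rw [hB c b fun h => hab (htrans _ _ _ h hc), mul_zero]
    · rw [hA a c hc, zero_mul]
  add_mem' := by
    intro A B hA hB a b hab
    rw [Matrix.add_apply, hA a b hab, hB a b hab, add_zero]
  algebraMap_mem' := by
    intro z a b hab
    have hne : a ≠ b := by
      rintro rfl
      exact hab (hrefl _)
    simp [Matrix.algebraMap_matrix_apply, hne]

theorem inv_mem_of_mem_subalgebra {ι : Type*} [Fintype ι] [DecidableEq ι]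
    (S : Subalgebra ℂ (Matrix ι ι ℂ)) {A : Matrix ι ι ℂ} (hA : A ∈ S) (hu : IsUnit A) :
    A⁻¹ ∈ S := by
  have hinj : Function.Injective (LinearMap.mulLeft ℂ (⟨A, hA⟩ : S)) := by
    intro B C hBC
    exact Subtype.ext (hu.mul_left_cancel (congrArg Subtype.val hBC))
  obtain ⟨B, hB⟩ := LinearMap.injective_iff_surjective.mp hinj 1
  have hAB : A * (B : Matrix ι ι ℂ) = 1 := congrArg Subtype.val hB
  rw [Matrix.inv_eq_right_inv hAB]
  exact B.2

theorem norm_matrix_mul_le {ι : Type*} [Fintype ι] (A B : Matrix ι ι ℂ) :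
    ‖A * B‖ ≤ Fintype.card ι * (‖A‖ * ‖B‖) := by
  rw [Matrix.norm_le_iff (by positivity)]
  intro a b
  rw [Matrix.mul_apply]
  calc ‖∑ c, A a c * B c b‖ ≤ ∑ _c : ι, ‖A‖ * ‖B‖ := by
        refine norm_sum_le_of_le _ fun c _ => ?_
        rw [norm_mul]
        gcongr
        · exact Matrix.norm_entry_le_entrywise_sup_norm A
        · exact Matrix.norm_entry_le_entrywise_sup_norm B
    _ = Fintype.card ι * (‖A‖ * ‖B‖) := by simp

/-- The part of a matrix supported on pairs of indices with equal labels. -/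
def diagPart {ι κ : Type*} [DecidableEq κ] (f : ι → κ) (A : Matrix ι ι ℂ) : Matrix ι ι ℂ :=
  Matrix.of fun a b => if f a = f b then A a b else 0

/-- The part of a matrix supported on pairs of indices with distinct labels. -/
def offDiagPart {ι κ : Type*} [DecidableEq κ] (f : ι → κ) (A : Matrix ι ι ℂ) : Matrix ι ι ℂ :=
  Matrix.of fun a b => if f a = f b then 0 else A a b

section Parts

variable {ι κ : Type*} [Fintype ι] [DecidableEq κ] (f : ι → κ)

theorem norm_diagPart_le (A : Matrix ι ι ℂ) : ‖diagPart f A‖ ≤ ‖A‖ := by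
  rw [Matrix.norm_le_iff (norm_nonneg _)]
  intro a b
  have h := Matrix.norm_entry_le_entrywise_sup_norm A (i := a) (j := b)
  by_cases hab : f a = f b <;> simp [diagPart, hab, h]

theorem norm_offDiagPart_le (A : Matrix ι ι ℂ) : ‖offDiagPart f A‖ ≤ ‖A‖ := by
  rw [Matrix.norm_le_iff (norm_nonneg _)]
  intro a b
  have h := Matrix.norm_entry_le_entrywise_sup_norm A (i := a) (j := b)
  by_cases hab : f a = f b <;> simp [offDiagPart, hab, h]

theorem offDiagPart_mul_diagPart (A B : Matrix ι ι ℂ) :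
    offDiagPart f A * diagPart f B = offDiagPart f (A * diagPart f B) := by
  ext a b
  simp only [offDiagPart, diagPart, Matrix.mul_apply, Matrix.of_apply]
  by_cases hab : f a = f b
  · rw [if_pos hab]
    refine Finset.sum_eq_zero fun c _ => ?_
    by_cases hc : f c = f b
    · rw [if_pos (hab.trans hc.symm), zero_mul]
    · rw [if_neg hc, mul_zero]
  · rw [if_neg hab]
    refine Finset.sum_congr rfl fun c _ => ?_
    by_cases hc : f c = f b
    · rw [if_neg fun h => hab (h.trans hc)]
    · rw [if_neg hc, mul_zero, mul_zero]

theorem diagPart_mul_diagPart (A B : Matrix ι ι ℂ) :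
    diagPart f A * diagPart f B = diagPart f (diagPart f A * B) := by
  ext a b
  simp only [diagPart, Matrix.mul_apply, Matrix.of_apply]
  by_cases hab : f a = f b
  · rw [if_pos hab]
    refine Finset.sum_congr rfl fun c _ => ?_
    by_cases hc : f a = f c
    · rw [if_pos (hc.symm.trans hab)]
    · rw [if_neg hc, zero_mul, zero_mul]
  · rw [if_neg hab]
    refine Finset.sum_eq_zero fun c _ => ?_
    by_cases hc : f a = f c
    · rw [if_neg fun h => hab (hc.trans h), mul_zero]
    · rw [if_neg hc, zero_mul]

/-- If the off-diagonal part of `A` is small relative to a bound on a two-sided inverse `G`, then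
the off-diagonal part of `G` is of the same order as that of `A`. -/
theorem norm_offDiagPart_inv_le [DecidableEq ι] {A G : Matrix ι ι ℂ} (hAG : A * G = 1)
    (hGA : G * A = 1) {M ε : ℝ} (hG : ‖G‖ ≤ M) (hE : ‖offDiagPart f A‖ ≤ ε)
    (hsmall : (Fintype.card ι : ℝ) ^ 2 * M * ε ≤ 1 / 2) :
    ‖offDiagPart f G‖ ≤ 2 * (Fintype.card ι : ℝ) ^ 2 * M ^ 2 * ε := by
  set n := (Fintype.card ι : ℝ)
  have hn : 0 ≤ n := Nat.cast_nonneg _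
  set D := diagPart f A
  set E := offDiagPart f A
  set P := diagPart f G
  set Q := offDiagPart f G
  have hM : 0 ≤ M := (norm_nonneg _).trans hG
  have hε : 0 ≤ ε := (norm_nonneg _).trans hE
  have hsplit : D + E = A := by
    ext a b
    by_cases hab : f a = f b <;> simp [D, E, diagPart, offDiagPart, hab]
  have hQD : Q * D = -offDiagPart f (G * E) := by
    have h : G * D = 1 - G * E := by rw [← hGA, ← hsplit]; noncomm_ring
    rw [offDiagPart_mul_diagPart, h]
    ext a b
    by_cases hab : f a = f b
    · simp [offDiagPart, hab]
    · have hne : a ≠ b := fun h => hab (congrArg f h)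
      simp [offDiagPart, hab, hne]
  have hDP : D * P = 1 - diagPart f (E * G) := by
    have h : D * G = 1 - E * G := by rw [← hAG, ← hsplit]; noncomm_ring
    rw [diagPart_mul_diagPart, h]
    ext a b
    by_cases hab : f a = f b
    · simp [diagPart, hab]
    · have hne : a ≠ b := fun h => hab (congrArg f h)
      simp [diagPart, hab, hne]
  have hQ : Q = Q * D * P + Q * diagPart f (E * G) := by
    rw [mul_assoc, hDP]; noncomm_ring
  have hP : ‖P‖ ≤ M := (norm_diagPart_le f G).trans hG
  have hQDn : ‖Q * D‖ ≤ n * (M * ε) := by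
    rw [hQD, norm_neg]
    refine (norm_offDiagPart_le f _).trans ((norm_matrix_mul_le G E).trans ?_)
    gcongr
  have hEG : ‖diagPart f (E * G)‖ ≤ n * (ε * M) := by
    refine (norm_diagPart_le f _).trans ((norm_matrix_mul_le E G).trans ?_)
    gcongr
  have h₁ : ‖Q * D * P‖ ≤ n * (n * (M * ε) * M) := by
    refine (norm_matrix_mul_le _ _).trans ?_
    gcongr
  have h₂ : ‖Q * diagPart f (E * G)‖ ≤ n * (‖Q‖ * (n * (ε * M))) := by
    refine (norm_matrix_mul_le _ _).trans ?_
    gcongr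
  have h₃ : ‖Q‖ ≤ n * (n * (M * ε) * M) + n * (‖Q‖ * (n * (ε * M))) :=
    calc ‖Q‖ = ‖Q * D * P + Q * diagPart f (E * G)‖ := congrArg _ hQ
      _ ≤ _ := (norm_add_le _ _).trans (add_le_add h₁ h₂)
  have h₄ := mul_le_mul_of_nonneg_left hsmall (norm_nonneg Q)
  nlinarith

end Parts

theorem norm_exp_mul_ofReal (s : ℂ) (τ : ℝ) :
    ‖Complex.exp (s * τ)‖ = Real.exp (s.re * τ) := by
  simp [Complex.norm_exp]

/-- The off-diagonal part of a member of `S_τ` decays like `e^{-τ Re s}`. -/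
theorem MemS.exists_norm_offDiagPart_le {N : ℕ} {m : Fin N → ℕ} {reach : Fin N → Fin N → Prop}
    {τ : ℝ} {K : ℂ → Matrix ((i : Fin N) × Fin (m i)) ((i : Fin N) × Fin (m i)) ℂ}
    (hK : MemS N m m reach τ K) :
    ∃ β C : ℝ, 0 ≤ C ∧ ∀ s : ℂ, β < s.re →
      ‖offDiagPart Sigma.fst (K s)‖ ≤ C * Real.exp (-(s.re * τ)) := by
  obtain ⟨β, -, hzero, -, hoff⟩ := hK
  have hblock : ∀ i j, ∃ c : ℝ, i ≠ j → ∀ s : ℂ, β < s.re →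
      ‖Complex.exp (s * τ) • blockOf (K s) i j‖ ≤ c := by
    intro i j
    by_cases hij : i = j
    · exact ⟨0, fun h => absurd hij h⟩
    by_cases hr : reach j i
    · obtain ⟨c, hc⟩ := hoff i j hij hr
      exact ⟨c, fun _ => hc⟩
    · refine ⟨0, fun _ s hs => ?_⟩
      rw [hzero s hs i j hr, smul_zero, norm_zero]
  choose c hc using hblock
  refine ⟨β, ∑ i, ∑ j, |c i j|, by positivity, fun s hs => ?_⟩
  rw [Matrix.norm_le_iff (by positivity)]
  rintro ⟨i, a⟩ ⟨j, b⟩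
  by_cases hij : i = j
  · simp only [offDiagPart, Matrix.of_apply, if_pos hij, norm_zero]
    positivity
  · simp only [offDiagPart, Matrix.of_apply, if_neg hij]
    have h₁ := (Matrix.norm_entry_le_entrywise_sup_norm _ (i := a) (j := b)).trans
      (hc i j hij s hs)
    rw [Matrix.smul_apply, norm_smul, norm_exp_mul_ofReal] at h₁
    have h₂ : c i j ≤ ∑ i, ∑ j, |c i j| :=
      (le_abs_self _).trans
        ((Finset.single_le_sum (f := fun j => |c i j|) (fun _ _ => abs_nonneg _)
          (Finset.mem_univ j)).trans
        (Finset.single_le_sum (f := fun i => ∑ j, |c i j|)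
          (fun _ _ => Finset.sum_nonneg fun _ _ => abs_nonneg _) (Finset.mem_univ i)))
    rw [Real.exp_neg, ← div_eq_mul_inv, le_div_iff₀ (Real.exp_pos _), mul_comm]
    exact h₁.trans h₂

theorem norm_blockOf_le {N : ℕ} {m p : Fin N → ℕ}
    (A : Matrix ((i : Fin N) × Fin (m i)) ((j : Fin N) × Fin (p j)) ℂ) (i j : Fin N) :
    ‖blockOf A i j‖ ≤ ‖A‖ := by
  rw [Matrix.norm_le_iff (norm_nonneg _)]
  exact fun a b => Matrix.norm_entry_le_entrywise_sup_norm A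

theorem norm_exp_smul_blockOf_le {N : ℕ} {m : Fin N → ℕ} {i j : Fin N} (hij : i ≠ j)
    {A : Matrix ((i : Fin N) × Fin (m i)) ((i : Fin N) × Fin (m i)) ℂ} {s : ℂ} {τ C : ℝ}
    (hA : ‖offDiagPart Sigma.fst A‖ ≤ C * Real.exp (-(s.re * τ))) :
    ‖Complex.exp (s * τ) • blockOf A i j‖ ≤ C := by
  have hblock : blockOf A i j = blockOf (offDiagPart Sigma.fst A) i j := by
    ext a b
    simp [blockOf, offDiagPart, hij]
  have := Matrix.normSMulClass (m := Fin (m i)) (n := Fin (m j)) (R := ℂ) (α := ℂ)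
  rw [norm_smul, norm_exp_mul_ofReal, hblock, mul_comm, ← le_div_iff₀ (Real.exp_pos _),
    div_eq_mul_inv, ← Real.exp_neg]
  exact (norm_blockOf_le _ i j).trans hA

theorem exists_forall_mul_exp_neg_le_half {τ : ℝ} (hτ : 0 < τ) (c : ℝ) :
    ∃ β : ℝ, ∀ x > β, c * Real.exp (-(x * τ)) ≤ 1 / 2 := by
  have hlim : Filter.Tendsto (fun x : ℝ => c * Real.exp (-(x * τ))) Filter.atTop (nhds 0) := by
    simpa using (Real.tendsto_exp_neg_atTop_nhds_zero.comp
      (Filter.tendsto_id.atTop_mul_const hτ)).const_mul c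
  obtain ⟨β, hβ⟩ := Filter.eventually_atTop.mp
    (hlim.eventually (ge_mem_nhds (by norm_num : (0 : ℝ) < 1 / 2)))
  exact ⟨β, fun x hx => hβ x hx.le⟩

/-- **`S_τ` is closed under inversion.** If `K ∈ S_τ` is square (diagonal blocks square)
and `K(s)` is invertible with uniformly bounded inverse on some half-plane `Re s > α`,
then there is `G ∈ S_τ` agreeing with `s ↦ K(s)⁻¹` on a half-plane; in particular the
inverse inherits the sparsity and delay structure of `S_τ`. -/
theorem memS_inv (N : ℕ) (m : Fin N → ℕ)
    (reach : Fin N → Fin N → Prop)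
    (hrefl : ∀ i, reach i i)
    (htrans : ∀ i j k, reach i j → reach j k → reach i k)
    (τ : ℝ) (hτ : 0 ≤ τ)
    (K : ℂ → Matrix ((i : Fin N) × Fin (m i)) ((i : Fin N) × Fin (m i)) ℂ)
    (hK : MemS N m m reach τ K)
    (α : ℝ) (hα : 0 < α) (Mbd : ℝ) (hMbd : 0 ≤ Mbd)
    (hinv : ∀ s : ℂ, α < s.re → IsUnit (K s) ∧ ‖(K s)⁻¹‖ ≤ Mbd) :
    ∃ G : ℂ → Matrix ((i : Fin N) × Fin (m i)) ((i : Fin N) × Fin (m i)) ℂ,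
      MemS N m m reach τ G ∧
        ∃ β : ℝ, α ≤ β ∧ ∀ s : ℂ, β < s.re → G s = (K s)⁻¹ := by
  obtain ⟨β, hβ, hzero, -⟩ := id hK
  obtain ⟨β', C, hC, hE⟩ := hK.exists_norm_offDiagPart_le
  have hdelay : ∃ γ C' : ℝ, ∀ s : ℂ, α < s.re → γ < s.re →
      ‖offDiagPart Sigma.fst (K s)⁻¹‖ ≤ C' * Real.exp (-(s.re * τ)) := by
    rcases hτ.eq_or_lt with rfl | hτ
    · refine ⟨0, Mbd, fun s hs _ => ?_⟩
      simpa using (norm_offDiagPart_le Sigma.fst _).trans (hinv s hs).2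
    · set n := (Fintype.card ((i : Fin N) × Fin (m i)) : ℝ)
      obtain ⟨γ, hγ⟩ := exists_forall_mul_exp_neg_le_half hτ (n ^ 2 * Mbd * C)
      refine ⟨max β' γ, 2 * n ^ 2 * Mbd ^ 2 * C, fun s hs hs' => ?_⟩
      obtain ⟨hs₁, hs₂⟩ := max_lt_iff.mp hs'
      have hdet := (Matrix.isUnit_iff_isUnit_det _).mp (hinv s hs).1
      have h := norm_offDiagPart_inv_le Sigma.fst (Matrix.mul_nonsing_inv _ hdet)
        (Matrix.nonsing_inv_mul _ hdet) (hinv s hs).2 (hE s hs₁)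
        (by rw [← mul_assoc]; exact hγ _ hs₂)
      rwa [← mul_assoc] at h
  obtain ⟨γ, C', hdelay⟩ := hdelay
  refine ⟨fun s => (K s)⁻¹, ⟨max α (max β γ), lt_max_of_lt_left hα, ?_, ?_, ?_⟩,
    α, le_rfl, fun _ _ => rfl⟩
  · intro s hs i j hij
    simp only [max_lt_iff] at hs
    have hmem : K s ∈ preorderSubalgebra
        (Sigma.fst : ((i : Fin N) × Fin (m i)) → Fin N) reach hrefl htrans :=
      fun a b hab => congrFun (congrFun (hzero s hs.2.1 a.1 b.1 hab) a.2) b.2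
    ext a b
    exact inv_mem_of_mem_subalgebra _ hmem (hinv s hs.1).1 ⟨i, a⟩ ⟨j, b⟩ hij
  · refine fun i => ⟨Mbd, fun s hs => ?_⟩
    exact (norm_blockOf_le _ i i).trans (hinv s (max_lt_iff.mp hs).1).2
  · refine fun i j hij _ => ⟨C', fun s hs => ?_⟩
    simp only [max_lt_iff] at hs
    exact norm_exp_smul_blockOf_le hij (hdelay s hs.1 hs.2.2)
end

section
/- Riccati solution ordering (first inequality of equation (13a) of the paper). Let A ∈ ℝ^{n×n}, B ∈ ℝ^{n×m}, C ∈ ℝ^{q×n}, D ∈ ℝ^{q×m} with DᵀD invertible, and let E_n ∈ ℝ^{n×k}, E_m ∈ ℝ^{m×l}, A' ∈ ℝ^{k×k}, B' ∈ ℝ^{k×l} satisfy A·E_n = E_n·A' and B·E_m = E_n·B'; set C' := C·E_n, D' := D·E_m with D'ᵀD' invertible. Suppose X = Xᵀ satisfies AᵀX + XA + CᵀC − (XB + CᵀD)(DᵀD)⁻¹(BᵀX + DᵀC) = 0, and X' = X'ᵀ satisfies A'ᵀX' + X'A' + C'ᵀC' − (X'B' + C'ᵀD')(D'ᵀD')⁻¹(B'ᵀX'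 + D'ᵀC') = 0 with F' := −(D'ᵀD')⁻¹(B'ᵀX' + D'ᵀC') and A' + B'F' Hurwitz. Then X' − E_nᵀ·X·E_n is positive semidefinite, i.e., X' ⪰ E_nᵀXE_n in the Loewner order. -/
open Matrix

/-- A real square matrix is Hurwitz if every eigenvalue (over `ℂ`) has negative real part. -/
def IsHurwitz {ι : Type*} [Fintype ι] [DecidableEq ι] (M : Matrix ι ι ℝ) : Prop :=
  ∀ μ ∈ spectrum ℂ (M.map Complex.ofReal), μ.re < 0

open Filter Topology

/-- In a complex Banach algebra, powers of an element with spectrum in the open unit disc tend to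
zero. -/
theorem tendsto_pow_zero_of_spectrum_norm_lt_one {A : Type*} [NormedRing A] [NormedAlgebra ℂ A]
    [CompleteSpace A] {a : A} (ha : ∀ z ∈ spectrum ℂ a, ‖z‖ < 1) :
    Tendsto (fun j : ℕ => a ^ j) atTop (𝓝 0) := by
  cases subsingleton_or_nontrivial A
  · exact tendsto_const_nhds.congr fun _ => Subsingleton.elim _ _
  have hr : spectralRadius ℂ a < (1 : NNReal) :=
    spectrum.spectralRadius_lt_of_forall_lt a fun z hz => by
      rw [← NNReal.coe_lt_coe]
      simpa using ha z hz
  obtain ⟨r, hr₀, hr₁⟩ := ENNReal.lt_iff_exists_nnreal_btwn.mp hr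
  have hev := (spectrum.pow_nnnorm_pow_one_div_tendsto_nhds_spectralRadius a).eventually_lt_const
    hr₀
  have hr₁' : (r : ℝ) < 1 := by exact_mod_cast hr₁
  refine squeeze_zero_norm' ?_ (tendsto_pow_atTop_nhds_zero_of_lt_one r.coe_nonneg hr₁')
  filter_upwards [hev, eventually_gt_atTop 0] with j hj hj₀
  have hj' : (j : ℝ) ≠ 0 := by positivity
  have h := ENNReal.rpow_le_rpow hj.le (Nat.cast_nonneg (α := ℝ) j)
  rw [← ENNReal.rpow_mul, one_div_mul_cancel hj', ENNReal.rpow_one, ENNReal.rpow_natCast] at h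
  exact_mod_cast h

/-- The Cayley transform maps the open left half-plane into the open unit disc. -/
theorem norm_lt_one_of_mem_spectrum_cayley {A : Type*} [Ring A] [Algebra ℂ A] {a r : A}
    (ha : ∀ z ∈ spectrum ℂ a, z.re < 0) (hl : (1 - a) * r = 1) (hr : r * (1 - a) = 1)
    {z : ℂ} (hz : z ∈ spectrum ℂ ((1 + a) * r)) : ‖z‖ < 1 := by
  have hru : IsUnit r := ⟨⟨r, 1 - a, hr, hl⟩, rfl⟩
  have hfac : algebraMap ℂ A z - (1 + a) * r =
      (algebraMap ℂ A (z - 1) - algebraMap ℂ A (z + 1) * a) * r := by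
    calc algebraMap ℂ A z - (1 + a) * r
        = algebraMap ℂ A z * ((1 - a) * r) - (1 + a) * r := by rw [hl, mul_one]
      _ = _ := by simp only [map_sub, map_add, map_one]; noncomm_ring
  rw [spectrum.mem_iff, hfac] at hz
  have hz₁ : z + 1 ≠ 0 := by
    intro h
    refine hz (IsUnit.mul ?_ hru)
    have h2 : z - 1 ≠ 0 := by
      rw [eq_neg_of_add_eq_zero_left h]; norm_num
    simpa [h] using (IsUnit.mk0 _ h2).map (algebraMap ℂ A)
  have hmem : (z - 1) / (z + 1) ∈ spectrum ℂ a := by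
    rw [spectrum.mem_iff]
    intro h
    refine hz (IsUnit.mul ?_ hru)
    have h' := ((IsUnit.mk0 _ hz₁).map (algebraMap ℂ A)).mul h
    rwa [mul_sub, ← map_mul, mul_div_cancel₀ _ hz₁] at h'
  have hre := ha _ hmem
  have hpos : 0 < Complex.normSq (z + 1) := Complex.normSq_pos.mpr hz₁
  rw [Complex.div_re, ← add_div, div_neg_iff] at hre
  have hnum := (hre.resolve_left fun h => absurd h.2 hpos.not_gt).1
  simp only [Complex.sub_re, Complex.add_re, Complex.sub_im, Complex.add_im, Complex.one_re,
    Complex.one_im] at hnum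
  rw [← sq_lt_one_iff₀ (norm_nonneg z), Complex.sq_norm, Complex.normSq_apply]
  nlinarith

namespace IsHurwitz

variable {ι : Type*} [Fintype ι] [DecidableEq ι] {M : Matrix ι ι ℝ}

theorem isUnit_one_sub (hM : IsHurwitz M) : IsUnit (1 - M) := by
  have h1 : (1 : ℂ) ∉ spectrum ℂ (M.map Complex.ofReal) := fun h => by
    simpa using (hM 1 h).trans zero_lt_one
  rw [spectrum.notMem_iff, map_one, Matrix.isUnit_iff_isUnit_det, isUnit_iff_ne_zero] at h1
  rw [Matrix.isUnit_iff_isUnit_det, isUnit_iff_ne_zero]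
  intro h
  apply h1
  have h2 := RingHom.map_det Complex.ofRealHom (1 - M)
  rw [h, map_zero, map_sub, map_one] at h2
  exact h2.symm

/-- The powers of the Cayley transform of a Hurwitz matrix tend to zero. -/
theorem tendsto_cayley_pow (hM : IsHurwitz M) :
    Tendsto (fun j : ℕ => ((1 + M) * (1 - M)⁻¹) ^ j) atTop (𝓝 0) := by
  have hdet := (Matrix.isUnit_iff_isUnit_det _).mp hM.isUnit_one_sub
  let φ := (Complex.ofRealHom.mapMatrix : Matrix ι ι ℝ →+* Matrix ι ι ℂ)
  have hl : (1 - φ M) * φ (1 - M)⁻¹ = 1 := by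
    rw [← map_one φ, ← map_sub, ← map_mul, Matrix.mul_nonsing_inv _ hdet]
  have hr : φ (1 - M)⁻¹ * (1 - φ M) = 1 := by
    rw [← map_one φ, ← map_sub, ← map_mul, Matrix.nonsing_inv_mul _ hdet]
  let _ : NormedRing (Matrix ι ι ℂ) := Matrix.linftyOpNormedRing
  let _ : NormedAlgebra ℂ (Matrix ι ι ℂ) := Matrix.linftyOpNormedAlgebra
  have ht : Tendsto (fun j : ℕ => ((1 + φ M) * φ (1 - M)⁻¹) ^ j) atTop (𝓝 0) :=
    tendsto_pow_zero_of_spectrum_norm_lt_one fun z hz =>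
      norm_lt_one_of_mem_spectrum_cayley (a := φ M) hM hl hr hz
  have hφ : ∀ j : ℕ, ((1 + φ M) * φ (1 - M)⁻¹) ^ j = φ (((1 + M) * (1 - M)⁻¹) ^ j) := fun j => by
    simp only [map_pow, map_mul, map_add, map_one]
  simp_rw [hφ] at ht
  refine tendsto_pi_nhds.mpr fun i => tendsto_pi_nhds.mpr fun j => ?_
  exact (Complex.continuous_re.tendsto _).comp
    (tendsto_pi_nhds.mp (tendsto_pi_nhds.mp ht i) j)

end IsHurwitz

section Stability

variable {ι : Type*} [Fintype ι] [DecidableEq ι]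

/-- A solution of the Stein inequality for a power-convergent matrix is positive semidefinite. -/
theorem posSemidef_of_stein {S P : Matrix ι ι ℝ} (hP : P.IsHermitian)
    (hS : Tendsto (fun j : ℕ => S ^ j) atTop (𝓝 0)) (h : (P - Sᵀ * P * S).PosSemidef) :
    P.PosSemidef := by
  refine .of_dotProduct_mulVec_nonneg hP fun x => ?_
  have hanti : ∀ j : ℕ, (P - (S ^ j)ᵀ * P * S ^ j).PosSemidef := by
    intro j
    induction j with
    | zero => simpa using PosSemidef.zero
    | succ j ih =>
      convert ih.add (h.conjTranspose_mul_mul_same (S ^ j)) using 1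
      rw [pow_succ', conjTranspose_eq_transpose_of_trivial, transpose_mul]
      noncomm_ring
  have hlim : Tendsto (fun j : ℕ => star x ⬝ᵥ ((P - (S ^ j)ᵀ * P * S ^ j) *ᵥ x)) atTop
      (𝓝 (star x ⬝ᵥ (P *ᵥ x))) := by
    have hc : Continuous fun T : Matrix ι ι ℝ => star x ⬝ᵥ ((P - Tᵀ * P * T) *ᵥ x) := by
      fun_prop
    simpa [Function.comp_def] using (hc.tendsto 0).comp hS
  exact ge_of_tendsto' hlim fun j => (hanti j).dotProduct_mulVec_nonneg x

/-- A solution of the Lyapunov inequality for a Hurwitz matrix is positive semidefinite. -/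
theorem IsHurwitz.posSemidef_of_lyapunov {M P : Matrix ι ι ℝ} (hM : IsHurwitz M)
    (hP : P.IsHermitian) (h : (-(Mᵀ * P + P * M)).PosSemidef) : P.PosSemidef := by
  refine posSemidef_of_stein hP hM.tendsto_cayley_pow ?_
  have hdet := (Matrix.isUnit_iff_isUnit_det _).mp hM.isUnit_one_sub
  set R := (1 - M)⁻¹
  have hl : (1 - M) * R = 1 := Matrix.mul_nonsing_inv _ hdet
  have hlt : Rᵀ * (1 - Mᵀ) = 1 := by
    simpa using congrArg transpose hl
  convert (h.add h).conjTranspose_mul_mul_same R using 1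
  rw [conjTranspose_eq_transpose_of_trivial, transpose_mul, transpose_add, transpose_one]
  calc P - Rᵀ * (1 + Mᵀ) * P * ((1 + M) * R)
      = (Rᵀ * (1 - Mᵀ)) * P * ((1 - M) * R) - Rᵀ * (1 + Mᵀ) * P * ((1 + M) * R) := by
        rw [hl, hlt, one_mul, mul_one]
    _ = _ := by noncomm_ring

end Stability

/-- Completion of the square for a solution of the control algebraic Riccati equation. -/
theorem riccati_complete_square {ν μ κ τ : Type*} [Fintype ν] [Fintype μ] [DecidableEq μ]
    [Fintype κ] {A : Matrix ν ν ℝ} {B : Matrix ν μ ℝ} {C : Matrix κ ν ℝ} {D : Matrix κ μ ℝ}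
    (hD : IsUnit (Dᵀ * D)) {X : Matrix ν ν ℝ} (hXsymm : X = Xᵀ)
    (hX : Aᵀ * X + X * A + Cᵀ * C -
      (X * B + Cᵀ * D) * (Dᵀ * D)⁻¹ * (Bᵀ * X + Dᵀ * C) = 0)
    (T : Matrix ν τ ℝ) (K : Matrix μ τ ℝ) :
    (A * T + B * K)ᵀ * (X * T) + Tᵀ * X * (A * T + B * K) + (C * T + D * K)ᵀ * (C * T + D * K) =
      (K + (Dᵀ * D)⁻¹ * (Bᵀ * X + Dᵀ * C) * T)ᵀ * (Dᵀ * D) *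
        (K + (Dᵀ * D)⁻¹ * (Bᵀ * X + Dᵀ * C) * T) := by
  have hdet := (Matrix.isUnit_iff_isUnit_det _).mp hD
  set L := Bᵀ * X + Dᵀ * C with hL
  have hLt : X * B + Cᵀ * D = Lᵀ := by
    rw [hL, transpose_add, transpose_mul, transpose_mul, transpose_transpose, transpose_transpose,
      ← hXsymm]
  have hWt : ((Dᵀ * D)⁻¹)ᵀ = (Dᵀ * D)⁻¹ := by
    rw [transpose_nonsing_inv, transpose_mul, transpose_transpose]
  have hleft : (A * T + B * K)ᵀ * (X * T) + Tᵀ * X * (A * T + B * K) +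
      (C * T + D * K)ᵀ * (C * T + D * K) =
      Tᵀ * (Aᵀ * X + X * A + Cᵀ * C) * T + Kᵀ * L * T + Tᵀ * (X * B + Cᵀ * D) * K +
        Kᵀ * (Dᵀ * D) * K := by
    rw [hL]
    simp only [transpose_add, transpose_mul, Matrix.mul_add, Matrix.add_mul, Matrix.mul_assoc]
    abel
  have hRW : ∀ Z : Matrix μ τ ℝ, Dᵀ * D * ((Dᵀ * D)⁻¹ * Z) = Z := fun Z =>
    Matrix.mul_nonsing_inv_cancel_left _ _ hdet
  have hWR : ∀ Z : Matrix μ τ ℝ, (Dᵀ * D)⁻¹ * (Dᵀ * D * Z) = Z := fun Z =>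
    Matrix.nonsing_inv_mul_cancel_left _ _ hdet
  rw [hleft, sub_eq_zero.mp hX, hLt]
  generalize Dᵀ * D = R at *
  simp only [transpose_add, transpose_mul, hWt, Matrix.mul_add, Matrix.add_mul, Matrix.mul_assoc,
    hRW, hWR]
  abel

/-- **Riccati solution ordering.** If `X` solves the global control ARE and `X'` solves
the compressed control ARE (with `A·E_n = E_n·A'`, `B·E_m = E_n·B'` encoding the
compression of block-diagonal dynamics) and the compressed closed loop `A' + B'F'` is
Hurwitz, then `X' ⪰ E_nᵀ·X·E_n` in the Loewner order. -/
theorem riccati_solution_ordering (n m q k l : ℕ)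
    (A : Matrix (Fin n) (Fin n) ℝ) (B : Matrix (Fin n) (Fin m) ℝ)
    (C : Matrix (Fin q) (Fin n) ℝ) (D : Matrix (Fin q) (Fin m) ℝ)
    (hD : IsUnit (Dᵀ * D))
    (En : Matrix (Fin n) (Fin k) ℝ) (Em : Matrix (Fin m) (Fin l) ℝ)
    (A' : Matrix (Fin k) (Fin k) ℝ) (B' : Matrix (Fin k) (Fin l) ℝ)
    (hAE : A * En = En * A') (hBE : B * Em = En * B')
    (C' : Matrix (Fin q) (Fin k) ℝ) (hC' : C' = C * En)
    (D' : Matrix (Fin q) (Fin l) ℝ) (hD'def : D' = D * Em)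
    (hD' : IsUnit (D'ᵀ * D'))
    (X : Matrix (Fin n) (Fin n) ℝ) (hXsymm : X = Xᵀ)
    (hX : Aᵀ * X + X * A + Cᵀ * C -
      (X * B + Cᵀ * D) * (Dᵀ * D)⁻¹ * (Bᵀ * X + Dᵀ * C) = 0)
    (X' : Matrix (Fin k) (Fin k) ℝ) (hX'symm : X' = X'ᵀ)
    (hX' : A'ᵀ * X' + X' * A' + C'ᵀ * C' -
      (X' * B' + C'ᵀ * D') * (D'ᵀ * D')⁻¹ * (B'ᵀ * X' + D'ᵀ * C') = 0)
    (F' : Matrix (Fin l) (Fin k) ℝ)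
    (hF' : F' = -((D'ᵀ * D')⁻¹ * (B'ᵀ * X' + D'ᵀ * C')))
    (hHur : IsHurwitz (A' + B' * F')) :
    (X' - Enᵀ * X * En).PosSemidef := by
  subst hC' hD'def
  have hglobal := riccati_complete_square hD hXsymm hX En (Em * F')
  have hlocal := riccati_complete_square hD' hX'symm hX' (1 : Matrix (Fin k) (Fin k) ℝ) F'
  have hzero : F' + ((D * Em)ᵀ * (D * Em))⁻¹ * (B'ᵀ * X' + (D * Em)ᵀ * (C * En)) *
      (1 : Matrix (Fin k) (Fin k) ℝ) = 0 := by
    rw [Matrix.mul_one, hF', neg_add_cancel]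
  rw [hzero] at hlocal
  simp only [Matrix.mul_one, transpose_one, Matrix.one_mul, transpose_zero, Matrix.zero_mul]
    at hlocal
  rw [hAE, ← Matrix.mul_assoc B, hBE, ← Matrix.mul_assoc D, Matrix.mul_assoc En B',
    ← Matrix.mul_add] at hglobal
  refine hHur.posSemidef_of_lyapunov ?_ ?_
  · rw [IsHermitian, conjTranspose_eq_transpose_of_trivial, transpose_sub, transpose_mul,
      transpose_mul, transpose_transpose, ← hXsymm, ← hX'symm, Matrix.mul_assoc]
  · set M := A' + B' * F'
    set H := Em * F' + (Dᵀ * D)⁻¹ * (Bᵀ * X + Dᵀ * C) * En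
    have hkey : -(Mᵀ * (X' - Enᵀ * X * En) + (X' - Enᵀ * X * En) * M) = (D * H)ᵀ * (D * H) := by
      have hH : (D * H)ᵀ * (D * H) = Hᵀ * (Dᵀ * D) * H := by
        simp only [transpose_mul, Matrix.mul_assoc]
      rw [hH, ← hglobal, eq_neg_of_add_eq_zero_right hlocal]
      simp only [transpose_mul, Matrix.mul_sub, Matrix.sub_mul, Matrix.mul_assoc]
      abel
    rw [hkey, ← conjTranspose_eq_transpose_of_trivial]
    exact posSemidef_conjTranspose_mul_self _
end
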